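/- Let $\alpha>0$, $\beta,\gamma\in\mathbb{R}$, $m\in\{0,1,2,\dots\}$, and let $\varepsilon\in(0,\pi^2)$. Let $F(b)=\exp\big(-b(\gamma-\tfrac{\beta^2}{4\alpha})\big)\sqrt{\tfrac{\pi}{b\alpha}}$ for $b>0$. Then there exist constants $K>0$ and $\delta>0$ such that for all $b\in(0,\delta)$: $\Big|\sum_{k\in\mathbb{Z}}(\alpha k^2+\beta k+\gamma)^m e^{-b(\alpha k^2+\beta k+\gamma)} - (-1)^m F^{(m)}(b)\Big| \le K\,\exp\big(-\tfrac{\pi^2-\varepsilon}{b\alpha}\big)$, where $F^{(m)}$ denotes the $m$-th derivative of $F$ with respect to $b$. -/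

import Mathlib

open Filter

noncomputable section

/-- The quadratic polynomial. -/
def qd (α β γ : ℝ) (k : ℤ) : ℝ := α * (k:ℝ) ^ 2 + β * k + γ

lemma qd_summable0 (α β γ : ℝ) (hα : 0 < α) (s : ℝ) (hs : 0 < s) :
    Summable (fun k : ℤ => Real.exp (-(s * qd α β γ k))) := by
  have hT : 0 < s * α / Real.pi := by positivity
  have h := (summable_pow_mul_jacobiTheta₂_term_bound (s * |β| / (2 * Real.pi)) hT 0).mul_left
    (Real.exp (-(s * γ)))
  refine Summable.of_nonneg_of_le (fun k => (Real.exp_pos _).le) (fun k => ?_) h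
  rw [pow_zero, one_mul, ← Real.exp_add, Real.exp_le_exp]
  have h1 : -(β * (k:ℝ)) ≤ |β| * |(k:ℝ)| := by
    rw [← abs_mul]; exact neg_le_abs _
  have h2 := mul_le_mul_of_nonneg_left h1 hs.le
  have h3 : -Real.pi * (s * α / Real.pi * (k:ℝ) ^ 2 - 2 * (s * |β| / (2 * Real.pi)) * |(k:ℝ)|)
      = -(s * α * (k:ℝ)^2) + s * (|β| * |(k:ℝ)|) := by
    field_simp
    ring
  push_cast
  rw [h3]
  unfold qd
  nlinarith

lemma abs_pow_le_exp (x t : ℝ) (ht : 0 < t) (m : ℕ) :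
    |x| ^ m ≤ m.factorial / t ^ m * (Real.exp (t * x) + Real.exp (-(t * x))) := by
  have h := Real.pow_div_factorial_le_exp (t * |x|) (by positivity) m
  have h2 : Real.exp (t * |x|) ≤ Real.exp (t * x) + Real.exp (-(t * x)) := by
    rcases abs_cases x with ⟨h, _⟩ | ⟨h, _⟩
    · rw [h]; linarith [Real.exp_pos (-(t * x))]
    · rw [h, mul_neg]; linarith [Real.exp_pos (t * x)]
  have h3 := h.trans h2
  have hf : (0:ℝ) < m.factorial := by positivity
  rw [div_le_iff₀ hf, mul_pow] at h3
  rw [div_mul_eq_mul_div, le_div_iff₀ (by positivity)]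
  linarith

lemma qd_summable (α β γ : ℝ) (hα : 0 < α) (m : ℕ) (s : ℝ) (hs : 0 < s) :
    Summable (fun k : ℤ => |qd α β γ k| ^ m * Real.exp (-(s * qd α β γ k))) := by
  have h := ((qd_summable0 α β γ hα (s/2) (by positivity)).add
    (qd_summable0 α β γ hα (s+s/2) (by positivity))).mul_left (m.factorial / (s/2) ^ m : ℝ)
  refine Summable.of_nonneg_of_le (fun k => by positivity) (fun k => ?_) h
  have := mul_le_mul_of_nonneg_right (abs_pow_le_exp (qd α β γ k) (s/2) (by positivity) m)
    (Real.exp_pos (-(s * qd α β γ k))).le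
  refine this.trans (le_of_eq ?_)
  rw [mul_assoc, add_mul, ← Real.exp_add, ← Real.exp_add]
  ring_nf

/-- Terms of the differentiated theta series. -/
def thT (α β γ : ℝ) (m : ℕ) (k : ℤ) (z : ℂ) : ℂ :=
  (-(qd α β γ k : ℂ)) ^ m * Complex.exp (-(z * (qd α β γ k : ℂ)))

/-- The differentiated theta series. -/
def th (α β γ : ℝ) (m : ℕ) (z : ℂ) : ℂ := ∑' k : ℤ, thT α β γ m k z

lemma norm_thT (α β γ : ℝ) (m : ℕ) (k : ℤ) (z : ℂ) :
    ‖thT α β γ m k z‖ = |qd α β γ k| ^ m * Real.exp (-(z.re * qd α β γ k)) := by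
  simp [thT, Complex.norm_exp]

lemma summable_thT (α β γ : ℝ) (hα : 0 < α) (m : ℕ) (z : ℂ) (hz : 0 < z.re) :
    Summable (fun k => thT α β γ m k z) := by
  apply Summable.of_norm
  simp only [norm_thT]
  exact qd_summable α β γ hα m _ hz

lemma hasDerivAt_th (α β γ : ℝ) (hα : 0 < α) (m : ℕ) (z : ℂ) (hz : 0 < z.re) :
    HasDerivAt (th α β γ m) (th α β γ (m+1) z) z := by
  set s := z.re / 2 with hs
  set S := 2 * z.re with hS
  have hs0 : 0 < s := by positivity
  have hS0 : 0 < S := by positivity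
  have hz1 : s < z.re := by linarith
  have hz2 : z.re < S := by linarith
  let t : Set ℂ := Complex.re ⁻¹' (Set.Ioo s S)
  have ht : IsOpen t := isOpen_Ioo.preimage Complex.continuous_re
  have htp : IsPreconnected t :=
    ((convex_Ioo s S).linear_preimage Complex.reLm).isPreconnected
  have hzt : z ∈ t := ⟨hz1, hz2⟩
  refine hasDerivAt_tsum_of_isPreconnected (t := t) (y₀ := z)
    ((qd_summable α β γ hα (m+1) s hs0).add (qd_summable α β γ hα (m+1) S hS0)) ht htp
    (g := fun k z => thT α β γ m k z) (g' := fun k z => thT α β γ (m+1) k z) ?_ ?_ hzt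
    (summable_thT α β γ hα m z hz) hzt
  · intro k y _
    have h1 : HasDerivAt (fun y : ℂ => -(y * (qd α β γ k : ℂ))) (-(qd α β γ k : ℂ)) y := by
      simpa using ((hasDerivAt_id y).mul_const (qd α β γ k : ℂ)).fun_neg
    have h2 := (h1.cexp).const_mul ((-(qd α β γ k : ℂ)) ^ m)
    have h3 : (-(qd α β γ k : ℂ)) ^ m * (Complex.exp (-(y * (qd α β γ k : ℂ))) *
        -(qd α β γ k : ℂ)) = thT α β γ (m+1) k y := by
      unfold thT
      ring
    rw [h3] at h2
    exact h2
  · intro k y hy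
    rw [norm_thT, ← mul_add]
    have hy1 : s < y.re := hy.1
    have hy2 : y.re < S := hy.2
    gcongr
    rcases le_total 0 (qd α β γ k) with h | h
    · have : Real.exp (-(y.re * qd α β γ k)) ≤ Real.exp (-(s * qd α β γ k)) := by
        rw [Real.exp_le_exp]; nlinarith
      linarith [Real.exp_pos (-(S * qd α β γ k))]
    · have : Real.exp (-(y.re * qd α β γ k)) ≤ Real.exp (-(S * qd α β γ k)) := by
        rw [Real.exp_le_exp]; nlinarith
      linarith [Real.exp_pos (-(s * qd α β γ k))]

lemma isOpen_rhp : IsOpen {z : ℂ | 0 < z.re} := isOpen_lt continuous_const Complex.continuous_re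

lemma iteratedDeriv_th (α β γ : ℝ) (hα : 0 < α) (m : ℕ) :
    ∀ z : ℂ, 0 < z.re → iteratedDeriv m (th α β γ 0) z = th α β γ m z := by
  induction m with
  | zero => intro z _; simp
  | succ m ih =>
    intro z hz
    rw [iteratedDeriv_succ]
    have : iteratedDeriv m (th α β γ 0) =ᶠ[nhds z] th α β γ m := by
      filter_upwards [isOpen_rhp.mem_nhds hz] with w hw using ih w hw
    rw [this.deriv_eq]
    exact (hasDerivAt_th α β γ hα m z hz).deriv

lemma differentiableOn_th (α β γ : ℝ) (hα : 0 < α) (m : ℕ) :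
    DifferentiableOn ℂ (th α β γ m) {z : ℂ | 0 < z.re} := fun z hz =>
  (hasDerivAt_th α β γ hα m z hz).differentiableAt.differentiableWithinAt

lemma differentiableOn_iteratedDeriv (f : ℂ → ℂ) (hf : DifferentiableOn ℂ f {z : ℂ | 0 < z.re})
    (m : ℕ) : DifferentiableOn ℂ (iteratedDeriv m f) {z : ℂ | 0 < z.re} := by
  induction m with
  | zero => simpa using hf
  | succ m ih => rw [iteratedDeriv_succ]; exact ih.deriv isOpen_rhp

lemma iteratedDeriv_re (f : ℂ → ℂ) (g : ℝ → ℝ) (hf : DifferentiableOn ℂ f {z : ℂ | 0 < z.re})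
    (hfg : ∀ x : ℝ, 0 < x → g x = (f x).re) (m : ℕ) :
    ∀ x : ℝ, 0 < x → iteratedDeriv m g x = (iteratedDeriv m f x).re := by
  induction m with
  | zero => simpa using hfg
  | succ m ih =>
    intro x hx
    rw [iteratedDeriv_succ, iteratedDeriv_succ]
    have : iteratedDeriv m g =ᶠ[nhds x] fun y : ℝ => (iteratedDeriv m f y).re := by
      filter_upwards [isOpen_Ioi.mem_nhds hx] with w hw using ih w hw
    rw [this.deriv_eq]
    have hd : HasDerivAt (iteratedDeriv m f) (deriv (iteratedDeriv m f) x) x :=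
      ((differentiableOn_iteratedDeriv f hf m).differentiableAt
        (isOpen_rhp.mem_nhds (by simpa using hx))).hasDerivAt
    exact hd.real_of_complex.deriv

/-- The complex main term. -/
def FC (α β γ : ℝ) (z : ℂ) : ℂ :=
  Complex.exp (-(z * (γ - β ^ 2 / (4 * α) : ℝ))) * (1 / (z * α / Real.pi) ^ (1 / 2 : ℂ))

lemma re_arg_pos (α : ℝ) (hα : 0 < α) (z : ℂ) (hz : 0 < z.re) :
    0 < (z * α / Real.pi).re := by
  rw [Complex.div_ofReal_re, Complex.re_mul_ofReal]
  positivity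

lemma differentiableOn_FC (α β γ : ℝ) (hα : 0 < α) :
    DifferentiableOn ℂ (FC α β γ) {z : ℂ | 0 < z.re} := by
  intro z hz
  apply DifferentiableAt.differentiableWithinAt
  have h := re_arg_pos α hα z hz
  have h0 : (z * α / Real.pi) ≠ 0 := fun h' => by rw [h'] at h; simp at h
  unfold FC
  refine DifferentiableAt.mul (by fun_prop) ?_
  refine DifferentiableAt.div (by fun_prop) ?_ ?_
  · exact DifferentiableAt.cpow (by fun_prop) (by fun_prop) (Or.inl h)
  · rw [Complex.cpow_ne_zero_iff]; exact Or.inl h0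

lemma FC_real (α β γ : ℝ) (hα : 0 < α) (b : ℝ) (hb : 0 < b) :
    Real.exp (-(b * (γ - β ^ 2 / (4 * α)))) * Real.sqrt (Real.pi / (b * α)) =
      (FC α β γ b).re := by
  have : FC α β γ b = ((Real.exp (-(b * (γ - β ^ 2 / (4 * α)))) *
      Real.sqrt (Real.pi / (b * α)) : ℝ) : ℂ) := by
    unfold FC
    have h1 : ((b:ℂ) * α / Real.pi) = ((b * α / Real.pi : ℝ) : ℂ) := by push_cast; rfl
    have h2 : (1 / 2 : ℂ) = ((1 / 2 : ℝ) : ℂ) := by push_cast; rfl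
    rw [h1, h2, ← Complex.ofReal_cpow (by positivity), ← Real.sqrt_eq_rpow]
    have h3 : Real.pi / (b * α) = (b * α / Real.pi)⁻¹ := by rw [inv_div]
    rw [h3, Real.sqrt_inv]
    push_cast
    simp
  rw [this, Complex.ofReal_re]

lemma th_poisson (α β γ : ℝ) (hα : 0 < α) (z : ℂ) (hz : 0 < z.re) :
    th α β γ 0 z = FC α β γ z * ∑' n : ℤ,
      Complex.exp (-(Real.pi ^ 2 * n ^ 2 / (z * α)) + ((Real.pi * n * β / α : ℝ) : ℂ) * Complex.I) := by
  have h := re_arg_pos α hα z hz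
  have hz0 : z ≠ 0 := fun h' => by rw [h'] at hz; simp at hz
  have hα0 : (α : ℂ) ≠ 0 := by exact_mod_cast hα.ne'
  have hpi : (Real.pi : ℂ) ≠ 0 := by exact_mod_cast Real.pi_ne_zero
  have key := Complex.tsum_exp_neg_quadratic h (-(z * β / (2 * Real.pi)))
  have e1 : th α β γ 0 z = Complex.exp (-(z * γ)) * ∑' n : ℤ, Complex.exp
      (-Real.pi * (z * α / Real.pi) * n ^ 2 + 2 * Real.pi * (-(z * β / (2 * Real.pi))) * n) := by
    rw [th, ← tsum_mul_left]
    refine tsum_congr fun n => ?_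
    rw [← Complex.exp_add, thT, pow_zero, one_mul, qd]
    congr 1
    push_cast
    field_simp
    ring
  rw [e1, key, FC, mul_assoc, mul_left_comm,
    mul_left_comm (Complex.exp (-(z * ((γ - β ^ 2 / (4 * α) : ℝ) : ℂ))))]
  congr 1
  rw [← tsum_mul_left, ← tsum_mul_left]
  refine tsum_congr fun n => ?_
  rw [← Complex.exp_add, ← Complex.exp_add]
  congr 1
  push_cast
  field_simp
  ring_nf
  simp only [Complex.I_sq]
  ring

lemma th_sub_FC_bound (α β γ : ℝ) (hα : 0 < α) (z : ℂ) (hz : 0 < z.re) (Y y0 : ℝ)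
    (hy0 : 0 < y0) (hY0 : y0 ≤ Y) (hY : Y ≤ (z⁻¹).re / α) :
    ‖th α β γ 0 z - FC α β γ z‖ ≤ ‖FC α β γ z‖ *
      ((∑' n : ℤ, Real.exp (-(y0 * qd (Real.pi ^ 2) 0 (-Real.pi ^ 2) n))) *
        Real.exp (-(Real.pi ^ 2 * Y))) := by
  set T : ℤ → ℂ := fun n => Complex.exp (-(Real.pi ^ 2 * n ^ 2 / (z * α)) +
    ((Real.pi * n * β / α : ℝ) : ℂ) * Complex.I) with hT
  have hpi2 : (0:ℝ) < Real.pi ^ 2 := by positivity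
  have hsum0 := qd_summable0 (Real.pi ^ 2) 0 (-Real.pi ^ 2) hpi2 y0 hy0
  have hsum := hsum0.mul_right (Real.exp (-(Real.pi ^ 2 * Y)))
  have hnorm : ∀ n : ℤ, ‖T n‖ = Real.exp (-(Real.pi ^ 2 * (n:ℝ) ^ 2 * ((z⁻¹).re / α))) := by
    intro n
    rw [hT]
    simp only [Complex.norm_exp, Complex.add_re, Complex.re_ofReal_mul, Complex.I_re, mul_zero,
      add_zero]
    congr 1
    have : ((Real.pi:ℂ) ^ 2 * n ^ 2 / (z * α)) =
        ((Real.pi ^ 2 * (n:ℝ) ^ 2 / α : ℝ) : ℂ) * z⁻¹ := by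
      push_cast
      rw [div_mul_eq_div_div, div_right_comm, div_eq_mul_inv _ z]
    rw [Complex.neg_re, this, Complex.re_ofReal_mul]
    ring
  have hle : ∀ n : ℤ, ‖T n - (if n = 0 then 1 else 0)‖ ≤
      Real.exp (-(y0 * qd (Real.pi ^ 2) 0 (-Real.pi ^ 2) n)) * Real.exp (-(Real.pi ^ 2 * Y)) := by
    intro n
    by_cases hn : n = 0
    · subst hn
      simp [hT]
      positivity
    · rw [if_neg hn, sub_zero, hnorm, ← Real.exp_add, Real.exp_le_exp]
      have h1 : (1:ℝ) ≤ (n:ℝ) ^ 2 := by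
        have : (1:ℤ) ≤ n ^ 2 := by
          have := sq_pos_of_ne_zero hn
          omega
        exact_mod_cast this
      have h2 : Real.pi ^ 2 * (n:ℝ) ^ 2 * Y ≤ Real.pi ^ 2 * (n:ℝ) ^ 2 * ((z⁻¹).re / α) := by
        gcongr
      have h3 : 0 ≤ Real.pi ^ 2 * (((n:ℝ) ^ 2 - 1) * (Y - y0)) :=
        mul_nonneg hpi2.le (mul_nonneg (by linarith) (by linarith))
      unfold qd
      nlinarith
  have hs1 : Summable (fun n => T n - (if n = 0 then (1:ℂ) else 0)) :=
    Summable.of_norm_bounded hsum hle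
  have hs2 : Summable (fun n : ℤ => if n = 0 then (1:ℂ) else 0) :=
    (hasSum_ite_eq (0:ℤ) (1:ℂ)).summable
  have hsT : Summable T := by
    have := hs1.add hs2
    simpa using this
  have e : ∑' n, (T n - (if n = 0 then (1:ℂ) else 0)) = (∑' n, T n) - 1 := by
    rw [hsT.tsum_sub hs2, tsum_ite_eq]
  rw [th_poisson α β γ hα z hz]
  have : FC α β γ z * (∑' n, T n) - FC α β γ z = FC α β γ z * ((∑' n, T n) - 1) := by ring
  rw [this, norm_mul, ← e, ← tsum_mul_right]
  gcongr
  exact tsum_of_norm_bounded hsum.hasSum hle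

lemma norm_FC_le (α β γ : ℝ) (hα : 0 < α) (b : ℝ) (hb : 0 < b) (z : ℂ)
    (hz1 : b / 2 ≤ ‖z‖) (hz2 : ‖z‖ ≤ 2) :
    ‖FC α β γ z‖ ≤ Real.exp (2 * |γ - β ^ 2 / (4 * α)|) * (1 + 2 * Real.pi / α * b⁻¹) := by
  unfold FC
  set c := γ - β ^ 2 / (4 * α)
  rw [norm_mul]
  gcongr
  · rw [Complex.norm_exp, Real.exp_le_exp, Complex.neg_re, Complex.re_mul_ofReal]
    calc -(z.re * c) ≤ |z.re * c| := neg_le_abs _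
      _ = |z.re| * |c| := abs_mul _ _
      _ ≤ 2 * |c| := by
        gcongr
        exact (Complex.abs_re_le_norm z).trans hz2
  · have h2 : (1 / 2 : ℂ) = ((1 / 2 : ℝ) : ℂ) := by push_cast; rfl
    rw [h2, norm_div, norm_one, Complex.norm_cpow_real, ← Real.sqrt_eq_rpow]
    have hw : ‖z * α / Real.pi‖ = ‖z‖ * α / Real.pi := by
      rw [norm_div, norm_mul, Complex.norm_real, Complex.norm_real, Real.norm_of_nonneg hα.le,
        Real.norm_of_nonneg Real.pi_pos.le]
    rw [hw]
    set t := ‖z‖ * α / Real.pi with ht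
    have hpi := Real.pi_pos
    have hzp : 0 < ‖z‖ := by linarith
    have htp : 0 < t := by positivity
    have htb : b / 2 * α / Real.pi ≤ t := by rw [ht]; gcongr
    have h3 : 2 * Real.pi / α * b⁻¹ = (b / 2 * α / Real.pi)⁻¹ := by
      field_simp
    have h4 : t⁻¹ ≤ 2 * Real.pi / α * b⁻¹ := by
      rw [h3]; exact inv_anti₀ (by positivity) htb
    have h5 : 1 / Real.sqrt t ≤ 1 + t⁻¹ := by
      have hs : 0 < Real.sqrt t := Real.sqrt_pos.2 htp
      have : t⁻¹ = (1 / Real.sqrt t) ^ 2 := by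
        rw [div_pow, Real.sq_sqrt htp.le, one_pow, one_div]
      rw [this]
      nlinarith [sq_nonneg (1 / Real.sqrt t - 1), sq_nonneg (1 / Real.sqrt t)]
    linarith

lemma inv_re_ge (b ρ : ℝ) (hb : 0 < b) (hρ : 0 < ρ) (hρ1 : ρ ≤ 1 / 2) (z : ℂ)
    (hz : ‖z - b‖ ≤ ρ * b) :
    0 < z.re ∧ b / 2 ≤ ‖z‖ ∧ ‖z‖ ≤ 2 * b ∧ 1 / (b * (1 + ρ)) ≤ (z⁻¹).re := by
  have hre : |z.re - b| ≤ ρ * b := by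
    have := Complex.abs_re_le_norm (z - b)
    simp only [Complex.sub_re, Complex.ofReal_re] at this
    linarith
  rw [abs_le] at hre
  have hx : b / 2 ≤ z.re := by nlinarith
  have hpos : 0 < z.re := by linarith
  have hn : ‖z‖ ≤ 2 * b := by
    have h1 : ‖z‖ ≤ ‖z - b‖ + ‖(b:ℂ)‖ := by
      simpa using norm_add_le (z - b) (b:ℂ)
    rw [Complex.norm_real, Real.norm_of_nonneg hb.le] at h1
    nlinarith
  refine ⟨hpos, hx.trans (Complex.re_le_norm z), hn, ?_⟩
  have hsq : (z.re - b) ^ 2 + z.im ^ 2 ≤ (ρ * b) ^ 2 := by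
    have h1 : ‖z - b‖ ^ 2 ≤ (ρ * b) ^ 2 := by gcongr
    rw [← Complex.normSq_eq_norm_sq, Complex.normSq_apply] at h1
    simp at h1
    nlinarith
  have hns : 0 < Complex.normSq z := by
    rw [Complex.normSq_pos]; intro h; rw [h] at hpos; simp at hpos
  rw [Complex.inv_re, div_le_div_iff₀ (by positivity) hns, Complex.normSq_apply]
  have h6 : 0 ≤ b * (1 - ρ) * (b * (1 + ρ) - z.re) :=
    mul_nonneg (mul_nonneg hb.le (by linarith)) (by linarith)
  nlinarith

lemma pow_absorb (κ : ℝ) (hκ : 0 < κ) (m : ℕ) (t : ℝ) (ht : 0 ≤ t) :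
    t ^ m * Real.exp (-(κ * t)) ≤ m.factorial / κ ^ m := by
  have h := Real.pow_div_factorial_le_exp (κ * t) (by positivity) m
  rw [Real.exp_neg, ← div_eq_mul_inv, div_le_div_iff₀ (Real.exp_pos _) (by positivity)]
  rw [div_le_iff₀ (by positivity), mul_pow] at h
  linarith

/-- Poisson-summation asymptotics: for `α > 0` and small `b > 0`,
`∑ₖ (αk²+βk+γ)^m e^{-b(αk²+βk+γ)}` equals `(-1)^m F^{(m)}(b)` up to an error
`O(exp(-(π²-ε)/(bα)))`, where `F(b) = exp(-b(γ-β²/(4α)))·√(π/(bα))`. -/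
theorem poisson_asymptotics (α β γ : ℝ) (hα : 0 < α) (m : ℕ) (ε : ℝ)
    (hε : ε ∈ Set.Ioo 0 (Real.pi ^ 2)) :
    ∃ K > 0, ∃ δ > 0, ∀ b ∈ Set.Ioo (0:ℝ) δ,
      |(∑' k : ℤ, (α * (k:ℝ) ^ 2 + β * k + γ) ^ m *
            Real.exp (-(b * (α * (k:ℝ) ^ 2 + β * k + γ)))) -
          (-1 : ℝ) ^ m * iteratedDeriv m
            (fun b : ℝ => Real.exp (-(b * (γ - β ^ 2 / (4 * α)))) * Real.sqrt (Real.pi / (b * α))) b| ≤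
        K * Real.exp (-((Real.pi ^ 2 - ε) / (b * α))) := by
  obtain ⟨hε0, hε1⟩ := hε
  have hpi := Real.pi_pos
  set ρ : ℝ := ε / (2 * Real.pi ^ 2) with hρdef
  have hρ : 0 < ρ := by positivity
  have hρ1 : ρ ≤ 1 / 2 := by
    rw [hρdef, div_le_div_iff₀ (by positivity) (by norm_num)]; linarith
  set y0 : ℝ := 1 / (2 * α) with hy0def
  have hy0 : 0 < y0 := by positivity
  set C0 : ℝ := ∑' n : ℤ, Real.exp (-(y0 * qd (Real.pi ^ 2) 0 (-Real.pi ^ 2) n)) with hC0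
  have hC0n : 0 ≤ C0 := tsum_nonneg fun n => (Real.exp_pos _).le
  set M : ℝ := Real.exp (2 * |γ - β ^ 2 / (4 * α)|) with hM
  have hMp : 0 < M := Real.exp_pos _
  set D : ℝ := 2 * Real.pi / α with hD
  have hDp : 0 < D := by positivity
  set κ : ℝ := ε / (2 * α) with hκdef
  have hκ : 0 < κ := by positivity
  set A : ℝ := m.factorial / ρ ^ m * M * C0 with hA
  have hAn : 0 ≤ A := by positivity
  refine ⟨A * (m.factorial / κ ^ m + D * ((m+1).factorial / κ ^ (m+1))) + 1, by positivity, 1,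
    one_pos, ?_⟩
  rintro b ⟨hb, hb1⟩
  have hbre : 0 < (b:ℂ).re := by simpa using hb
  -- reduction to the complex error term
  have hFre := iteratedDeriv_re (FC α β γ)
    (fun b : ℝ => Real.exp (-(b * (γ - β ^ 2 / (4 * α)))) * Real.sqrt (Real.pi / (b * α)))
    (differentiableOn_FC α β γ hα) (fun x hx => FC_real α β γ hα x hx) m b hb
  have hthre : (∑' k : ℤ, (α * (k:ℝ) ^ 2 + β * k + γ) ^ m *
      Real.exp (-(b * (α * (k:ℝ) ^ 2 + β * k + γ)))) = (-1:ℝ) ^ m * (th α β γ m b).re := by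
    rw [th, Complex.re_tsum (summable_thT α β γ hα m b hbre), ← tsum_mul_left]
    refine tsum_congr fun k => ?_
    have : thT α β γ m k b = (((-qd α β γ k) ^ m * Real.exp (-(b * qd α β γ k)) : ℝ) : ℂ) := by
      unfold thT; push_cast; rfl
    rw [this, Complex.ofReal_re, ← mul_assoc, ← mul_pow]
    simp [qd]
  have hsub : iteratedDeriv m (th α β γ 0 - FC α β γ) (b:ℂ) =
      th α β γ m b - iteratedDeriv m (FC α β γ) b := by
    have hnh := isOpen_rhp.mem_nhds (show (b:ℂ) ∈ {z : ℂ | 0 < z.re} from hbre)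
    rw [iteratedDeriv_sub, iteratedDeriv_th α β γ hα m b hbre]
    · exact ((differentiableOn_th α β γ hα 0).contDiffOn isOpen_rhp).contDiffAt hnh
    · exact ((differentiableOn_FC α β γ hα).contDiffOn isOpen_rhp).contDiffAt hnh
  rw [hthre, hFre, ← mul_sub, abs_mul, abs_pow, abs_neg, abs_one, one_pow, one_mul,
    ← Complex.sub_re, ← hsub]
  refine (Complex.abs_re_le_norm _).trans ?_
  -- Cauchy estimate
  have hcl : ∀ z ∈ Metric.closedBall (b:ℂ) (ρ * b), ‖z - b‖ ≤ ρ * b := fun z hz => by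
    simpa [dist_eq_norm] using hz
  have hdiff : DiffContOnCl ℂ (th α β γ 0 - FC α β γ) (Metric.ball (b:ℂ) (ρ * b)) := by
    apply DifferentiableOn.diffContOnCl
    refine ((differentiableOn_th α β γ hα 0).sub (differentiableOn_FC α β γ hα)).mono ?_
    intro z hz
    exact (inv_re_ge b ρ hb hρ hρ1 z (hcl z (Metric.closure_ball_subset_closedBall hz))).1
  set Y : ℝ := 1 / (b * (1 + ρ)) / α with hY
  have hbound : ∀ z ∈ Metric.sphere (b:ℂ) (ρ * b), ‖(th α β γ 0 - FC α β γ) z‖ ≤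
      (M * (1 + D * b⁻¹)) * (C0 * Real.exp (-(Real.pi ^ 2 * Y))) := by
    intro z hz
    obtain ⟨h1, h2, h3, h4⟩ := inv_re_ge b ρ hb hρ hρ1 z
      (hcl z (Metric.sphere_subset_closedBall hz))
    have hYy : y0 ≤ Y := by
      rw [hY, hy0def, div_div]
      apply one_div_le_one_div_of_le (by positivity)
      gcongr
      nlinarith
    have := th_sub_FC_bound α β γ hα z h1 Y y0 hy0 hYy (by rw [hY]; gcongr)
    refine this.trans ?_
    have h5 := norm_FC_le α β γ hα b hb z h2 (by linarith)
    gcongr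
  have hR : 0 < ρ * b := by positivity
  refine (Complex.norm_iteratedDeriv_le_of_forall_mem_sphere_norm_le m hR hdiff hbound).trans ?_
  -- final absorption
  have hexp : Real.exp (-(Real.pi ^ 2 * Y)) ≤
      Real.exp (-(κ * b⁻¹)) * Real.exp (-((Real.pi ^ 2 - ε) / (b * α))) := by
    rw [← Real.exp_add, Real.exp_le_exp]
    have h1 : -(κ * b⁻¹) + -((Real.pi ^ 2 - ε) / (b * α)) =
        -((Real.pi ^ 2 - ε / 2) / (b * α)) := by
      rw [hκdef]; field_simp; ring
    have h2 : Real.pi ^ 2 * Y = Real.pi ^ 2 / (1 + ρ) / (b * α) := by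
      rw [hY]; field_simp
    rw [h1, h2, neg_le_neg_iff]
    gcongr
    rw [le_div_iff₀ (by positivity)]
    have h3 : Real.pi ^ 2 * ρ = ε / 2 := by rw [hρdef]; field_simp
    nlinarith
  have a1 := pow_absorb κ hκ m b⁻¹ (by positivity)
  have a2 := pow_absorb κ hκ (m+1) b⁻¹ (by positivity)
  set P := Real.exp (-(κ * b⁻¹))
  set Q := Real.exp (-((Real.pi ^ 2 - ε) / (b * α)))
  have hQ : 0 < Q := Real.exp_pos _
  calc m.factorial * ((M * (1 + D * b⁻¹)) * (C0 * Real.exp (-(Real.pi ^ 2 * Y)))) / (ρ * b) ^ m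
      ≤ m.factorial * ((M * (1 + D * b⁻¹)) * (C0 * (P * Q))) / (ρ * b) ^ m := by gcongr
    _ = A * (b⁻¹ ^ m * P + D * (b⁻¹ ^ (m+1) * P)) * Q := by
      rw [hA, mul_pow, inv_pow, inv_pow]; field_simp; ring
    _ ≤ A * (m.factorial / κ ^ m + D * ((m+1).factorial / κ ^ (m+1))) * Q := by gcongr
    _ ≤ _ := by gcongr; linarith
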